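/- For each β > 0 let π^{(β)}(λ) = β^m·Π_{i=1}^m e^{−β λ_i} for λ ∈ (0,∞)^m, and let δ^{(β)} be the estimator δ^{(β)}_i(x,y) = ((x·+y+m−1)/(2+β))·x_i/(x·+m−1) (the Bayes estimator of λ under the prior π^{(β)}). Then: (a) for every β > 0, ∫_{(0,∞)^m} π^{(β)}(λ) dλ = 1; and (b) limsup_{β → 0+} ∫_{(0,∞)^m} R(δ^{(β)}, λ)·π^{(β)}(λ) dλ ≥ m − 1/2. -/

import Mathlib

open scoped BigOperators ENNReal

/-- The Poisson(μ) probability of the value `k`. -/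
noncomputable def poissonPmf (mu : ℝ) (k : ℕ) : ℝ :=
  mu ^ k * Real.exp (-mu) / (Nat.factorial k)

/-- Joint pmf of (X, Y): X_1, …, X_m, Y independent, X_i ~ Po(λ_i), Y ~ Po(Σ λ_i). -/
noncomputable def jointPmf (m : ℕ) (lam : Fin m → ℝ) (x : Fin m → ℕ) (y : ℕ) : ℝ :=
  poissonPmf (∑ i, lam i) y * ∏ i, poissonPmf (lam i) (x i)

/-- Risk of an estimator δ under the standardized squared error loss, valued in [0,∞]. -/
noncomputable def risk (m : ℕ) (δ : (Fin m → ℕ) → ℕ → Fin m → ℝ) (lam : Fin m → ℝ) : ℝ≥0∞ :=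
  ∑' x : Fin m → ℕ, ∑' y : ℕ,
    ENNReal.ofReal ((∑ i, (δ x y i - lam i) ^ 2 / lam i) * jointPmf m lam x y)

/-- The maximum likelihood estimator λ^ML (real division by zero is 0, giving 0/0 = 0). -/
noncomputable def estML (m : ℕ) (x : Fin m → ℕ) (y : ℕ) (i : Fin m) : ℝ :=
  ((∑ j, (x j : ℝ)) + (y : ℝ)) / 2 * ((x i : ℝ) / ∑ j, (x j : ℝ))

/-- The shrinkage estimator λ^O. -/
noncomputable def estO (m : ℕ) (x : Fin m → ℕ) (y : ℕ) (i : Fin m) : ℝ :=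
  ((∑ j, (x j : ℝ)) + (y : ℝ) + (m : ℝ) - 1) / 2 *
    ((x i : ℝ) / ((∑ j, (x j : ℝ)) + (m : ℝ) - 1))

/-- The second shrinkage estimator λ̂. -/
noncomputable def estHat (m : ℕ) (x : Fin m → ℕ) (y : ℕ) (i : Fin m) : ℝ :=
  ((∑ j, (x j : ℝ)) + (y : ℝ)) / 2 * ((x i : ℝ) / ((∑ j, (x j : ℝ)) + (m : ℝ) - 1))

/-- The Clevenson–Zidek estimator λ̂X based on X alone. -/
noncomputable def estCZ (m : ℕ) (x : Fin m → ℕ) (y : ℕ) (i : Fin m) : ℝ :=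
  (∑ j, (x j : ℝ)) * (x i : ℝ) / ((∑ j, (x j : ℝ)) + (m : ℝ) - 1)

/-- The exponential prior π^{(β)}(λ) = β^m Π_i e^{−β λ_i}. -/
noncomputable def priorBeta (m : ℕ) (β : ℝ) (lam : Fin m → ℝ) : ℝ :=
  β ^ m * ∏ i, Real.exp (-β * lam i)

/-- The Bayes estimator δ^{(β)} under the prior π^{(β)}. -/
noncomputable def estBeta (m : ℕ) (β : ℝ) (x : Fin m → ℕ) (y : ℕ) (i : Fin m) : ℝ :=
  ((∑ j, (x j : ℝ)) + (y : ℝ) + (m : ℝ) - 1) / (2 + β) *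
    ((x i : ℝ) / ((∑ j, (x j : ℝ)) + (m : ℝ) - 1))

open MeasureTheory Filter Topology

lemma poissonPmf_nonneg {mu : ℝ} (hmu : 0 ≤ mu) (k : ℕ) : 0 ≤ poissonPmf mu k := by
  unfold poissonPmf; positivity

lemma succ_mul_poissonPmf_succ (mu : ℝ) (k : ℕ) :
    ((k : ℝ) + 1) * poissonPmf mu (k + 1) = mu * poissonPmf mu k := by
  have h1 : (Nat.factorial k : ℝ) ≠ 0 := by positivity
  have h2 : (k : ℝ) + 1 ≠ 0 := by positivity
  simp only [poissonPmf, Nat.factorial_succ]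
  push_cast
  field_simp
  ring

lemma hasSum_poissonPmf (mu : ℝ) : HasSum (poissonPmf mu) 1 := by
  have h := (NormedSpace.expSeries_div_hasSum_exp (𝔸 := ℝ) mu).mul_right (Real.exp (-mu))
  rw [← Real.exp_eq_exp_ℝ, ← Real.exp_add, add_neg_cancel, Real.exp_zero] at h
  refine h.congr_fun ?_
  intro k
  simp only [poissonPmf]
  ring

/-- The Stein identity `E[K h(K)] = μ E[h(K + 1)]` for a Poisson variable. -/
lemma HasSum.poissonPmf_stein {mu a : ℝ} {h : ℝ → ℝ}
    (ha : HasSum (fun k : ℕ => h (k + 1) * poissonPmf mu k) a) :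
    HasSum (fun k : ℕ => k * h k * poissonPmf mu k) (mu * a) := by
  rw [← (Nat.succ_injective).hasSum_iff]
  · refine (ha.mul_left mu).congr_fun ?_
    intro k
    have := succ_mul_poissonPmf_succ mu k
    simp only [Function.comp, Nat.succ_eq_add_one]
    push_cast
    linear_combination (h (k + 1)) * this
  · intro k hk
    cases k with
    | zero => simp
    | succ n => exact absurd ⟨n, rfl⟩ hk

lemma hasSum_mul_poissonPmf (mu : ℝ) :
    HasSum (fun k : ℕ => (k : ℝ) * poissonPmf mu k) mu := by
  have := HasSum.poissonPmf_stein (mu := mu) (a := 1) (h := fun _ => 1)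
    (by simpa using hasSum_poissonPmf mu)
  simpa using this

lemma hasSum_sq_mul_poissonPmf (mu : ℝ) :
    HasSum (fun k : ℕ => (k : ℝ) ^ 2 * poissonPmf mu k) (mu ^ 2 + mu) := by
  have := HasSum.poissonPmf_stein (mu := mu) (a := mu + 1) (h := fun t => t)
    (by simpa [add_mul] using (hasSum_mul_poissonPmf mu).add (hasSum_poissonPmf mu))
  convert this using 1
  · ext k; ring
  · ring

section Product

variable {m : ℕ} {lam : Fin m → ℝ}

lemma prod_poissonPmf_nonneg (hl : ∀ i, 0 < lam i) (x : Fin m → ℕ) :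
    0 ≤ ∏ i, poissonPmf (lam i) (x i) :=
  Finset.prod_nonneg fun i _ => poissonPmf_nonneg (hl i).le _

lemma hasSum_prod_poissonPmf (hl : ∀ i, 0 < lam i) :
    HasSum (fun x : Fin m → ℕ => ∏ i, poissonPmf (lam i) (x i)) 1 := by
  let μ : Measure (Fin m → ℕ) :=
    Measure.pi fun i => ProbabilityTheory.poissonMeasure (lam i).toNNReal
  have h1 : ∀ x, μ {x} = ENNReal.ofReal (∏ i, poissonPmf (lam i) (x i)) := by
    intro x
    rw [Measure.pi_singleton, ENNReal.ofReal_prod_of_nonneg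
      fun i _ => poissonPmf_nonneg (hl i).le _]
    refine Finset.prod_congr rfl fun i _ => ?_
    rw [ProbabilityTheory.poissonMeasure_singleton, Real.coe_toNNReal _ (hl i).le, poissonPmf,
      mul_comm (Real.exp _)]
  have h2 : ∑' x, μ {x} = 1 := by
    have := Measure.tsum_indicator_apply_singleton μ Set.univ MeasurableSet.univ
    simpa using this
  simp_rw [h1] at h2
  have hs : Summable (fun x : Fin m → ℕ => ∏ i, poissonPmf (lam i) (x i)) := by
    have h3 := ENNReal.summable_toReal (h2.trans_ne ENNReal.one_ne_top)
    simpa [ENNReal.toReal_ofReal (prod_poissonPmf_nonneg hl _)] using h3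
  rw [← ENNReal.ofReal_tsum_of_nonneg (prod_poissonPmf_nonneg hl) hs, ENNReal.ofReal_eq_one] at h2
  exact h2 ▸ hs.hasSum

lemma succ_mul_prod_poissonPmf_add_single (lam : Fin m → ℝ) (x : Fin m → ℕ) (i : Fin m) :
    ((x i : ℝ) + 1) * ∏ j, poissonPmf (lam j) ((x + Pi.single i 1 : Fin m → ℕ) j) =
      lam i * ∏ j, poissonPmf (lam j) (x j) := by
  rw [Fintype.prod_eq_mul_prod_compl i,
    Fintype.prod_eq_mul_prod_compl i (fun j => poissonPmf (lam j) (x j)), ← mul_assoc, ← mul_assoc]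
  congr 1
  · simpa using succ_mul_poissonPmf_succ (lam i) (x i)
  · refine Finset.prod_congr rfl fun j hj => ?_
    have : j ≠ i := by simpa using hj
    simp [this]

/-- The Stein identity in one coordinate of a vector of independent Poisson variables. -/
lemma HasSum.prod_poissonPmf_stein {a : ℝ} {h : (Fin m → ℕ) → ℝ} (i : Fin m)
    (ha : HasSum (fun x : Fin m → ℕ => h (x + Pi.single i 1) * ∏ j, poissonPmf (lam j) (x j)) a) :
    HasSum (fun x : Fin m → ℕ => (x i : ℝ) * h x * ∏ j, poissonPmf (lam j) (x j)) (lam i * a) := by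
  rw [← (add_left_injective (Pi.single i 1 : Fin m → ℕ)).hasSum_iff]
  · refine (ha.mul_left (lam i)).congr_fun ?_
    intro x
    have := succ_mul_prod_poissonPmf_add_single lam x i
    simp only [Function.comp, Pi.add_apply, Pi.single_eq_same] at this ⊢
    push_cast
    linear_combination (h (x + Pi.single i 1)) * this
  · intro x hx
    have : x i = 0 := by
      by_contra h0
      refine hx ⟨x - Pi.single i 1, ?_⟩
      ext j
      by_cases hj : j = i
      · subst hj; simp; omega
      · simp [hj]
    simp [this]

lemma sum_cast_add_single (x : Fin m → ℕ) (i : Fin m) :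
    ∑ j, (((x + Pi.single i 1 : Fin m → ℕ) j : ℕ) : ℝ) = ∑ j, (x j : ℝ) + 1 := by
  simp [Finset.sum_add_distrib, Pi.single_apply]

lemma HasSum.sum_mul_prod_poissonPmf {a : ℝ} {g : ℝ → ℝ}
    (ha : HasSum (fun x : Fin m → ℕ =>
      g (∑ j, (x j : ℝ) + 1) * ∏ j, poissonPmf (lam j) (x j)) a) :
    HasSum (fun x : Fin m → ℕ =>
      (∑ j, (x j : ℝ)) * g (∑ j, (x j : ℝ)) * ∏ j, poissonPmf (lam j) (x j))
      ((∑ i, lam i) * a) := by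
  have h1 : ∀ i ∈ Finset.univ, HasSum (fun x : Fin m → ℕ =>
      (x i : ℝ) * g (∑ j, (x j : ℝ)) * ∏ j, poissonPmf (lam j) (x j)) (lam i * a) := fun i _ =>
    HasSum.prod_poissonPmf_stein (h := fun x => g (∑ j, (x j : ℝ))) i
      (by simpa only [sum_cast_add_single] using ha)
  simpa only [Finset.sum_mul] using hasSum_sum h1

lemma HasSum.sum_sq_div_mul_prod_poissonPmf (hl : ∀ i, 0 < lam i) {a : ℝ} {g : ℝ → ℝ}
    (hg : ∀ t, 0 ≤ g t)
    (ha : HasSum (fun x : Fin m → ℕ =>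
      (∑ j, (x j : ℝ) + m) * g (∑ j, (x j : ℝ) + 1) * ∏ j, poissonPmf (lam j) (x j)) a) :
    HasSum (fun x : Fin m → ℕ =>
      (∑ i, (x i : ℝ) ^ 2 / lam i) * g (∑ j, (x j : ℝ)) * ∏ j, poissonPmf (lam j) (x j)) a := by
  have hsum : ∀ i, Summable (fun x : Fin m → ℕ =>
      ((x i : ℝ) + 1) * g (∑ j, (x j : ℝ) + 1) * ∏ j, poissonPmf (lam j) (x j)) := by
    intro i
    refine Summable.of_nonneg_of_le (fun x => ?_) (fun x => ?_) ha.summable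
    · exact mul_nonneg (mul_nonneg (by positivity) (hg _)) (prod_poissonPmf_nonneg hl x)
    · refine mul_le_mul_of_nonneg_right (mul_le_mul_of_nonneg_right ?_ (hg _))
        (prod_poissonPmf_nonneg hl x)
      have h1 : (x i : ℝ) ≤ ∑ j, (x j : ℝ) :=
        Finset.single_le_sum (f := fun j => (x j : ℝ)) (fun _ _ => by positivity)
          (Finset.mem_univ i)
      have h2 : (1 : ℝ) ≤ m := by
        have : 1 ≤ m := by have := i.2; omega
        exact_mod_cast this
      linarith
  have h1 : ∀ i ∈ Finset.univ, HasSum (fun x : Fin m → ℕ =>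
      (x i : ℝ) ^ 2 / lam i * g (∑ j, (x j : ℝ)) * ∏ j, poissonPmf (lam j) (x j))
      (∑' x : Fin m → ℕ,
        ((x i : ℝ) + 1) * g (∑ j, (x j : ℝ) + 1) * ∏ j, poissonPmf (lam j) (x j)) := by
    intro i _
    have h2 := HasSum.prod_poissonPmf_stein (lam := lam)
      (h := fun x => (x i : ℝ) * g (∑ j, (x j : ℝ))) i
      (by
        simp only [sum_cast_add_single]
        simpa only [Pi.add_apply, Pi.single_eq_same, Nat.cast_add, Nat.cast_one]
          using (hsum i).hasSum)
    have h3 := h2.mul_left (lam i)⁻¹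
    rw [inv_mul_cancel_left₀ (hl i).ne'] at h3
    refine h3.congr_fun ?_
    intro x
    ring
  have h2 := hasSum_sum (fun i (_ : i ∈ Finset.univ) => (hsum i).hasSum)
  have h3 : ∑ i, ∑' x : Fin m → ℕ,
      ((x i : ℝ) + 1) * g (∑ j, (x j : ℝ) + 1) * ∏ j, poissonPmf (lam j) (x j) = a := by
    refine h2.unique ?_
    simpa only [← Finset.sum_mul, Finset.sum_add_distrib, Finset.sum_const, Finset.card_univ,
      Fintype.card_fin, nsmul_eq_mul, mul_one] using ha
  rw [← h3]
  simpa only [Finset.sum_mul] using hasSum_sum h1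

/-- The mean of `1 / (N + m)` for `N = X_1 + ⋯ + X_m`. -/
noncomputable def meanInv (m : ℕ) (lam : Fin m → ℝ) : ℝ :=
  ∑' x : Fin m → ℕ, (∑ j, (x j : ℝ) + m)⁻¹ * ∏ j, poissonPmf (lam j) (x j)

lemma hasSum_meanInv (hm : 1 ≤ m) (hl : ∀ i, 0 < lam i) :
    HasSum (fun x : Fin m → ℕ => (∑ j, (x j : ℝ) + m)⁻¹ * ∏ j, poissonPmf (lam j) (x j))
      (meanInv m lam) := by
  refine Summable.hasSum (Summable.of_nonneg_of_le (fun x => ?_) (fun x => ?_)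
    (hasSum_prod_poissonPmf hl).summable)
  · exact mul_nonneg (by positivity) (prod_poissonPmf_nonneg hl x)
  · refine mul_le_of_le_one_left (prod_poissonPmf_nonneg hl x) (inv_le_one_of_one_le₀ ?_)
    have h2 : (1 : ℝ) ≤ m := by exact_mod_cast hm
    have : 0 ≤ ∑ j, (x j : ℝ) := by positivity
    linarith

lemma sum_add_sub_one_mul_meanInv_le (hm : 1 ≤ m) (hl : ∀ i, 0 < lam i) :
    (∑ i, lam i + m - 1) * meanInv m lam ≤ 1 := by
  have hJ := hasSum_meanInv hm hl
  have h1 : HasSum (fun x : Fin m → ℕ => (∑ j, (x j : ℝ)) * (∑ j, (x j : ℝ) + m - 1)⁻¹ *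
      ∏ j, poissonPmf (lam j) (x j)) ((∑ i, lam i) * meanInv m lam) :=
    HasSum.sum_mul_prod_poissonPmf (g := fun t => (t + m - 1)⁻¹)
      (by simpa only [add_right_comm _ (1 : ℝ), add_sub_cancel_right] using hJ)
  have h2 := (hasSum_prod_poissonPmf hl).sub (hJ.mul_left ((m : ℝ) - 1))
  have h3 := hasSum_le (fun x => ?_) h1 h2
  · linarith
  · rw [← mul_assoc, ← one_sub_mul]
    refine mul_le_mul_of_nonneg_right ?_ (prod_poissonPmf_nonneg hl x)
    have hm1 : (1 : ℝ) ≤ m := by exact_mod_cast hm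
    have hN : 0 ≤ ∑ j, (x j : ℝ) := by positivity
    generalize ∑ j, (x j : ℝ) = N at *
    rcases (add_nonneg hN (sub_nonneg.2 hm1)).eq_or_lt with h0 | h0
    · have hm2 : (m : ℝ) = 1 := by linarith
      have hN0 : N = 0 := by linarith
      simp [hm2, hN0]
    · have hD : 0 < N + m - 1 := by linarith
      have hD' : 0 < N + m := by linarith
      rw [← sub_nonneg]
      have : 1 - ((m : ℝ) - 1) * (N + m)⁻¹ - N * (N + m - 1)⁻¹ =
          (m - 1) / ((N + m) * (N + m - 1)) := by
        field_simp
        ring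
      rw [this]
      exact div_nonneg (by linarith) (by positivity)

/-- Conditionally on `X = x`, the expected loss of `c (D + Y) q` as an estimator of `λ`. -/
lemma hasSum_loss_mul_jointPmf (hl : ∀ i, 0 < lam i) (c D : ℝ) (q : Fin m → ℝ) (x : Fin m → ℕ) :
    HasSum (fun y : ℕ => (∑ i, (c * (D + y) * q i - lam i) ^ 2 / lam i) * jointPmf m lam x y)
      ((c ^ 2 * (∑ i, q i ^ 2 / lam i) *
          (D ^ 2 + 2 * D * (∑ i, lam i) + ((∑ i, lam i) ^ 2 + ∑ i, lam i)) -
        2 * c * (∑ i, q i) * (D + ∑ i, lam i) + ∑ i, lam i) * ∏ j, poissonPmf (lam j) (x j)) := by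
  set L := ∑ i, lam i with hL
  have hsq : ∀ y : ℝ, ∑ i, (c * (D + y) * q i - lam i) ^ 2 / lam i =
      c ^ 2 * (D + y) ^ 2 * (∑ i, q i ^ 2 / lam i) - 2 * c * (D + y) * (∑ i, q i) + L := by
    intro y
    rw [Finset.mul_sum, Finset.mul_sum, hL, ← Finset.sum_sub_distrib, ← Finset.sum_add_distrib]
    refine Finset.sum_congr rfl fun i _ => ?_
    have := (hl i).ne'
    field_simp
    ring
  set S := ∑ i, q i ^ 2 / lam i
  set Q := ∑ i, q i
  have h := ((((hasSum_poissonPmf L).mul_left (c ^ 2 * S * D ^ 2 - 2 * c * D * Q + L)).add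
    ((hasSum_mul_poissonPmf L).mul_left (2 * c ^ 2 * S * D - 2 * c * Q))).add
    ((hasSum_sq_mul_poissonPmf L).mul_left (c ^ 2 * S))).mul_right
      (∏ j, poissonPmf (lam j) (x j))
  convert h using 1
  · rfl
  · ext y
    rw [hsq, jointPmf, ← hL]
    ring
  · ring

lemma risk_estBeta (hm : 1 ≤ m) (hl : ∀ i, 0 < lam i) (β : ℝ) :
    risk m (estBeta m β) lam = ENNReal.ofReal
      (((2 + β)⁻¹) ^ 2 * (3 * (∑ i, lam i) + m +
          ((∑ i, lam i) ^ 2 + ∑ i, lam i) * meanInv m lam) -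
        2 * (2 + β)⁻¹ * ((∑ i, lam i) + (∑ i, lam i) ^ 2 * meanInv m lam) + ∑ i, lam i) := by
  set c := (2 + β)⁻¹ with hc
  have hinner := fun x : Fin m → ℕ => hasSum_loss_mul_jointPmf hl c (∑ j, (x j : ℝ) + m - 1)
    (fun i => (x i : ℝ) / (∑ j, (x j : ℝ) + m - 1)) x
  have hest : ∀ (x : Fin m → ℕ) (y : ℕ) (i : Fin m), estBeta m β x y i =
      c * (∑ j, (x j : ℝ) + m - 1 + y) * ((x i : ℝ) / (∑ j, (x j : ℝ) + m - 1)) := by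
    intro x y i
    rw [estBeta, hc]
    ring
  simp_rw [← hest] at hinner
  set L := ∑ i, lam i with hL
  have hL0 : 0 ≤ L := Finset.sum_nonneg fun i _ => (hl i).le
  have hnn : ∀ x y, 0 ≤ (∑ i, (estBeta m β x y i - lam i) ^ 2 / lam i) * jointPmf m lam x y :=
    fun x y => mul_nonneg (Finset.sum_nonneg fun i _ => div_nonneg (sq_nonneg _) (hl i).le)
      (mul_nonneg (poissonPmf_nonneg hL0 _) (prod_poissonPmf_nonneg hl x))
  have hm1 : (1 : ℝ) ≤ m := by exact_mod_cast hm
  have hone := hasSum_prod_poissonPmf hl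
  have hJ := hasSum_meanInv hm hl
  have hN : HasSum (fun x : Fin m → ℕ => (∑ j, (x j : ℝ)) * ∏ j, poissonPmf (lam j) (x j)) L := by
    simpa using HasSum.sum_mul_prod_poissonPmf (lam := lam) (a := 1) (g := fun _ => 1)
      (by simpa using hone)
  have hpos : ∀ x : Fin m → ℕ, ∑ j, (x j : ℝ) + (m : ℝ) ≠ 0 := fun x => by
    have : 0 ≤ ∑ j, (x j : ℝ) := by positivity
    linarith
  have h2 : HasSum (fun x : Fin m → ℕ => (∑ i, (x i : ℝ) ^ 2 / lam i) *
      (((∑ j, (x j : ℝ) + m - 1) ^ 2 + 2 * |∑ j, (x j : ℝ) + m - 1| * L + (L ^ 2 + L)) /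
        (∑ j, (x j : ℝ) + m - 1) ^ 2) * ∏ j, poissonPmf (lam j) (x j))
      (3 * L + m + (L ^ 2 + L) * meanInv m lam) := by
    refine HasSum.sum_sq_div_mul_prod_poissonPmf hl (g := fun t =>
      ((t + m - 1) ^ 2 + 2 * |t + m - 1| * L + (L ^ 2 + L)) / (t + m - 1) ^ 2)
      (fun t => by positivity) ?_
    convert (hN.add (hone.mul_left (m + 2 * L))).add (hJ.mul_left (L ^ 2 + L)) using 1
    · ext x
      have h0 := hpos x
      have h0' : |∑ j, (x j : ℝ) + (m : ℝ)| = ∑ j, (x j : ℝ) + (m : ℝ) :=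
        abs_of_nonneg (by positivity)
      simp only [add_right_comm _ (1 : ℝ), add_sub_cancel_right, h0']
      field_simp
      ring
    · ring
  have h3 : HasSum (fun x : Fin m → ℕ => (∑ j, (x j : ℝ)) *
      ((∑ j, (x j : ℝ) + m - 1)⁻¹ * (∑ j, (x j : ℝ) + m - 1 + L)) *
        ∏ j, poissonPmf (lam j) (x j)) (L * (1 + L * meanInv m lam)) := by
    refine HasSum.sum_mul_prod_poissonPmf (g := fun t => (t + m - 1)⁻¹ * (t + m - 1 + L)) ?_
    convert hone.add (hJ.mul_left L) using 1
    ext x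
    have h0 := hpos x
    simp only [add_right_comm _ (1 : ℝ), add_sub_cancel_right]
    field_simp
  have houter : HasSum (fun x : Fin m → ℕ => ∑' y : ℕ,
      (∑ i, (estBeta m β x y i - lam i) ^ 2 / lam i) * jointPmf m lam x y)
      (c ^ 2 * (3 * L + m + (L ^ 2 + L) * meanInv m lam) -
        2 * c * (L + L ^ 2 * meanInv m lam) + L) := by
    convert ((h2.mul_left (c ^ 2)).sub (h3.mul_left (2 * c))).add (hone.mul_left L) using 1
    · rfl
    · ext x
      rw [(hinner x).tsum_eq]
      have hD : |∑ j, (x j : ℝ) + (m : ℝ) - 1| = ∑ j, (x j : ℝ) + (m : ℝ) - 1 := by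
        refine abs_of_nonneg ?_
        have : 0 ≤ ∑ j, (x j : ℝ) := by positivity
        linarith
      rw [hD]
      have e1 : ∑ i, ((x i : ℝ) / (∑ j, (x j : ℝ) + m - 1)) ^ 2 / lam i =
          (∑ i, (x i : ℝ) ^ 2 / lam i) / (∑ j, (x j : ℝ) + m - 1) ^ 2 := by
        rw [Finset.sum_div]
        exact Finset.sum_congr rfl fun i _ => by rw [div_pow, div_right_comm]
      rw [e1, ← Finset.sum_div]
      ring
    · ring
  rw [risk, ← houter.tsum_eq,
    ENNReal.ofReal_tsum_of_nonneg (fun x => tsum_nonneg (hnn x)) houter.summable]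
  exact tsum_congr fun x => (ENNReal.ofReal_tsum_of_nonneg (hnn x) (hinner x).summable).symm

lemma quadratic_risk_lower_bound {L J c M : ℝ} (hL : 1 ≤ L) (hM : 1 ≤ M) (hc : 0 ≤ c) (hc' : c ≤ 1 / 2)
    (hJ : (L + M - 1) * J ≤ 1) :
    c ^ 2 * (M + 1) + (2 * c - c ^ 2) * (M - 1) - 2 * M ^ 2 / L ≤
      c ^ 2 * (3 * L + M + (L ^ 2 + L) * J) - 2 * c * (L + L ^ 2 * J) + L := by
  have hL0 : 0 < L := by linarith
  have hW : L ^ 2 * J ≤ L - (M - 1) + M ^ 2 / L := by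
    have h1 : J ≤ 1 / (L + M - 1) := by
      rw [le_div_iff₀ (by linarith)]; linarith
    have h2 : L ^ 2 * J ≤ L ^ 2 * (1 / (L + M - 1)) := by gcongr
    refine h2.trans ?_
    rw [← sub_nonneg]
    have : 0 < L + M - 1 := by linarith
    have e : L - (M - 1) + M ^ 2 / L - L ^ 2 * (1 / (L + M - 1)) =
        ((2 * M - 1) * L + M ^ 2 * (M - 1)) / (L * (L + M - 1)) := by
      field_simp
      ring
    rw [e]
    have : 0 ≤ M ^ 2 * (M - 1) := mul_nonneg (sq_nonneg _) (by linarith)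
    have : 0 ≤ (2 * M - 1) * L := mul_nonneg (by linarith) hL0.le
    positivity
  have hu1 : 1 / L ≤ 1 := by rw [div_le_one hL0]; exact hL
  have hu0 : 0 < 1 / L := by positivity
  set u := 1 / L with hu
  have hLu : L * u = 1 := by rw [hu]; field_simp
  have hJW : L * J = u * (L ^ 2 * J) := by linear_combination (-(L * J)) * hLu
  have hM' : M ^ 2 / L = M ^ 2 * u := by rw [hu]; ring
  rw [mul_div_assoc, hM']
  rw [hM'] at hW
  set W := L ^ 2 * J with hWdef
  have hcoef : 0 ≤ 2 * c - c ^ 2 - c ^ 2 * u := by nlinarith [mul_nonneg hc hc]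
  have hk := mul_le_mul_of_nonneg_left hW hcoef
  have e : c ^ 2 * (3 * L + M + (L ^ 2 + L) * J) - 2 * c * (L + W) + L =
      c ^ 2 * (3 * L + M) - 2 * c * L + L - (2 * c - c ^ 2 - c ^ 2 * u) * W := by
    linear_combination c ^ 2 * hJW
  rw [e]
  have hsq : 0 ≤ L * (1 - 2 * c) ^ 2 := by positivity
  have h5 : (2 * c - c ^ 2 - c ^ 2 * u) * (M ^ 2 * u) ≤ M ^ 2 * u := by
    refine mul_le_of_le_one_left (by positivity) ?_
    nlinarith [mul_nonneg (mul_nonneg hc hc) hu0.le]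
  have h6 : c ^ 2 * u * (M - 1) ≤ M ^ 2 * u := by
    have : c ^ 2 * (M - 1) ≤ M ^ 2 := by nlinarith
    nlinarith
  have h7 : c ^ 2 * u * L = c ^ 2 := by linear_combination c ^ 2 * hLu
  nlinarith

end Product

lemma lintegral_priorBeta_pi_Ioi (m : ℕ) {β : ℝ} (hβ : 0 < β) (K : ℝ) :
    ∫⁻ lam in Set.univ.pi (fun _ : Fin m => Set.Ioi K), ENNReal.ofReal (priorBeta m β lam) =
      ENNReal.ofReal (Real.exp (-(β * K)) ^ m) := by
  have hint : Integrable (fun t : ℝ => Real.exp (-β * t)) (volume.restrict (Set.Ioi K)) :=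
    integrableOn_exp_mul_Ioi (by linarith) K
  rw [volume_pi, Measure.restrict_pi_pi, ← ofReal_integral_eq_lintegral_ofReal]
  · congr 1
    simp only [priorBeta]
    rw [integral_const_mul, integral_fintype_prod_eq_pow (fun t => Real.exp (-β * t)),
      integral_exp_mul_Ioi (by linarith), Fintype.card_fin, ← mul_pow]
    congr 1
    rw [neg_mul]
    field_simp
  · exact (Integrable.fintype_prod fun _ => hint).const_mul _
  · exact Eventually.of_forall fun lam => by
      simp only [priorBeta, Pi.zero_apply]
      positivity

/- STATEMENT 5: (a) each π^{(β)} is a probability density on (0,∞)^m, and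
(b) the limsup as β → 0+ of the Bayes risks of δ^{(β)} is at least m − 1/2. -/
theorem stmt_5 (m : ℕ) (hm : 1 ≤ m) :
    (∀ β : ℝ, 0 < β →
      (∫⁻ lam in Set.univ.pi (fun _ : Fin m => Set.Ioi (0 : ℝ)),
        ENNReal.ofReal (priorBeta m β lam)) = 1) ∧
    ENNReal.ofReal ((m : ℝ) - 1 / 2) ≤
      Filter.limsup
        (fun β : ℝ =>
          ∫⁻ lam in Set.univ.pi (fun _ : Fin m => Set.Ioi (0 : ℝ)),
            risk m (estBeta m β) lam * ENNReal.ofReal (priorBeta m β lam))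
        (nhdsWithin (0 : ℝ) (Set.Ioi 0)) := by
  refine ⟨fun β hβ => by simpa using lintegral_priorBeta_pi_Ioi m hβ 0, ?_⟩
  have hm1 : (1 : ℝ) ≤ m := by exact_mod_cast hm
  let G : ℝ → ℝ := fun β =>
    (((2 + β)⁻¹) ^ 2 * (m + 1) + (2 * (2 + β)⁻¹ - ((2 + β)⁻¹) ^ 2) * (m - 1) -
      2 * (m : ℝ) ^ 2 * √β) * Real.exp (-√β) ^ m
  have hG : Tendsto (fun β => ENNReal.ofReal (G β)) (𝓝[>] 0)
      (𝓝 (ENNReal.ofReal ((m : ℝ) - 1 / 2))) := by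
    refine (ENNReal.continuous_ofReal.tendsto _).comp (tendsto_nhdsWithin_of_tendsto_nhds ?_)
    have hcont : ContinuousAt G 0 := by
      have h2 : (2 : ℝ) + 0 ≠ 0 := by norm_num
      have hinv : ContinuousAt (fun β : ℝ => (2 + β)⁻¹) 0 :=
        ContinuousAt.inv₀ (by fun_prop) h2
      fun_prop
    have h0 : G 0 = (m : ℝ) - 1 / 2 := by
      simp only [G, Real.sqrt_zero]
      norm_num
      ring
    rw [← h0]
    exact hcont
  rw [← hG.limsup_eq]
  refine limsup_le_limsup ?_
  filter_upwards [Ioo_mem_nhdsGT (zero_lt_one (α := ℝ))] with β hβ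
  have hβ0 : 0 < β := hβ.1
  have hs0 : 0 < √β := Real.sqrt_pos.2 hβ0
  have hs1 : √β ≤ 1 := Real.sqrt_le_one.2 hβ.2.le
  have hK : 1 ≤ (√β)⁻¹ := (one_le_inv₀ hs0).2 hs1
  have hβK : β * (√β)⁻¹ = √β := by
    rw [← div_eq_mul_inv, Real.div_sqrt]
  have hprior := lintegral_priorBeta_pi_Ioi m hβ0 (√β)⁻¹
  rw [hβK] at hprior
  have hsub : Set.univ.pi (fun _ : Fin m => Set.Ioi (√β)⁻¹) ⊆
      Set.univ.pi (fun _ : Fin m => Set.Ioi (0 : ℝ)) :=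
    Set.pi_mono fun i _ => Set.Ioi_subset_Ioi (by positivity)
  refine le_trans ?_ (lintegral_mono_set hsub)
  simp only [G]
  rw [ENNReal.ofReal_mul' (by positivity), ← hprior, ← lintegral_const_mul' _ _ ENNReal.ofReal_ne_top]
  refine setLIntegral_mono' (MeasurableSet.univ_pi fun _ => measurableSet_Ioi) fun lam hlam => ?_
  refine mul_le_mul_left ?_ _
  have hlamK : ∀ i, (√β)⁻¹ < lam i := fun i => hlam i (Set.mem_univ i)
  have hl : ∀ i, 0 < lam i := fun i => (inv_pos.2 hs0).trans (hlamK i)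
  have hLK : (√β)⁻¹ ≤ ∑ i, lam i :=
    (hlamK ⟨0, hm⟩).le.trans
      (Finset.single_le_sum (fun i _ => (hl i).le) (Finset.mem_univ _))
  rw [risk_estBeta hm hl]
  refine ENNReal.ofReal_le_ofReal (le_trans ?_ (quadratic_risk_lower_bound (hK.trans hLK) hm1
    (inv_nonneg.2 (by linarith)) ?_ (sum_add_sub_one_mul_meanInv_le hm hl)))
  · rw [div_eq_mul_inv]
    have : (∑ i, lam i)⁻¹ ≤ √β := inv_le_of_inv_le₀ hs0 hLK
    gcongr
  · rw [one_div]
    exact inv_anti₀ (by norm_num) (by linarith)
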